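/- Let G be a simple graph with at least one edge (so N_2(G) > 0). Then G contains a cycle of length t for every integer t with 3 ≤ t ≤ 3·N_3(G)/N_2(G) + 2. -/

import Mathlib

/-- `cliqueCount G j` is `N_j(G)`, the number of `j`-vertex cliques (copies of `K_j`) in `G`;
in particular `cliqueCount G 2` is the number of edges and `cliqueCount G 3` the number
of triangles. -/
noncomputable def cliqueCount {V : Type*} (G : SimpleGraph V) (j : ℕ) : ℕ :=
  Set.ncard {s : Finset V | G.IsNClique j s}

open Classical in
/-- there is a path on `m` vertices inside `S` -/
def PathIn {V : Type*} (G : SimpleGraph V) (S : Finset V) (m : ℕ) : Prop :=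
  ∃ l : List V, l.length = m ∧ l.Nodup ∧ l.IsChain G.Adj ∧ ∀ x ∈ l, x ∈ S

open Classical in
/-- degree of `x` into `S` -/
noncomputable def dIn {V : Type*} (G : SimpleGraph V) (S : Finset V) (x : V) : ℕ :=
  (S.filter (G.Adj x)).card

theorem rot_extend {V : Type*} (G : SimpleGraph V) (S : Finset V) (c : List V)
    (hnd : c.Nodup) (hch : c.IsChain G.Adj) (hS : ∀ x ∈ c, x ∈ S)
    (hcl : ∀ x ∈ c.getLast?, ∀ y ∈ c.head?, G.Adj x y)
    (x z : V) (hx : x ∈ c) (hz : z ∉ c) (hzS : z ∈ S) (hxz : G.Adj x z) :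
    PathIn G S (c.length + 1) := by
  obtain ⟨P, Q, rfl⟩ := List.append_of_mem hx
  refine ⟨z :: ((x :: Q) ++ P), by simp; omega, ?_, ?_, ?_⟩
  · rw [List.nodup_cons]
    refine ⟨by simp at hz ⊢; tauto, ?_⟩
    exact (List.perm_append_comm.nodup_iff).1 hnd
  · rw [List.isChain_append] at hch
    rw [List.cons_append, List.isChain_cons_cons, ← List.cons_append, List.isChain_append]
    refine ⟨hxz.symm, hch.2.1, hch.1, ?_⟩
    intro a ha b hb
    apply hcl
    · simp at ha ⊢
      simp [ha]
    · cases P <;> simp_all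
  · intro a ha
    simp at ha
    rcases ha with rfl | rfl | h | h
    · exact hzS
    · exact hS _ (by simp)
    · exact hS _ (by simp [h])
    · exact hS _ (by simp [h])

theorem getLast?_take_aux {V : Type*} (p : List V) (i : ℕ) (hi : i < p.length) (a : V)
    (h : a ∈ (p.take (i+1)).getLast?) : a = p[i] := by
  rw [List.getLast?_take, if_neg (by omega), Nat.add_sub_cancel,
    List.getElem?_eq_getElem hi] at h
  exact (Option.some.inj h).symm

theorem posa {V : Type*} (G : SimpleGraph V) (S : Finset V) (k m : ℕ) (hm : m ≤ k) (hm0 : 1 ≤ m)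
    (hdeg : ∀ x ∈ S, k ≤ 2 * dIn G S x)
    (hp : PathIn G S m) (hnp : ¬ PathIn G S (m + 1)) :
    ∃ c : List V, c.length = m ∧ c.Nodup ∧ c.IsChain G.Adj ∧ (∀ x ∈ c, x ∈ S) ∧
      (∀ x ∈ c.getLast?, ∀ y ∈ c.head?, G.Adj x y) := by
  classical
  obtain ⟨p, hl, hnd, hch, hS⟩ := hp
  have h0 : 0 < p.length := by omega
  have hlast : m - 1 < p.length := by omega
  have hne : p ≠ [] := by rintro rfl; simp at h0
  -- neighbours of the endpoints lie on the path
  have hN0 : ∀ z ∈ S, G.Adj p[0] z → z ∈ p := by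
    intro z hz hadj
    by_contra hzp
    apply hnp
    refine ⟨z :: p, by simp [hl], List.nodup_cons.2 ⟨hzp, hnd⟩, ?_, ?_⟩
    · cases p with
      | nil => simp
      | cons a p => exact List.isChain_cons_cons.2 ⟨by simpa using hadj.symm, hch⟩
    · intro x hx
      rcases List.mem_cons.1 hx with rfl | hx
      · exact hz
      · exact hS _ hx
  have hN1 : ∀ z ∈ S, G.Adj p[m-1] z → z ∈ p := by
    intro z hz hadj
    by_contra hzp
    apply hnp
    refine ⟨p ++ [z], by simp [hl], ?_, ?_, ?_⟩
    · exact (List.perm_append_comm.nodup_iff).1 (List.nodup_cons.2 ⟨hzp, hnd⟩ : ([z] ++ p).Nodup)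
    · rw [List.isChain_append]
      refine ⟨hch, by simp, ?_⟩
      intro a ha b hb
      simp at hb
      subst hb
      rw [List.getLast?_eq_getElem?, hl, List.getElem?_eq_getElem hlast] at ha
      simp at ha
      rw [← ha]; exact hadj
    · intro x hx
      simp at hx
      rcases hx with hx | rfl
      · exact hS _ hx
      · exact hz
  let A := (Finset.range (m-1)).filter (fun i => ∃ h : i + 1 < p.length, G.Adj p[0] p[i+1])
  let B := (Finset.range (m-1)).filter (fun i => ∃ h : i < p.length, G.Adj p[m-1] p[i])
  have hA : dIn G S p[0] ≤ A.card := by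
    have : S.filter (G.Adj p[0]) ⊆ A.image (fun i => p.getD (i+1) p[0]) := by
      intro z hz
      rw [Finset.mem_filter] at hz
      obtain ⟨i, hi, rfl⟩ := List.getElem_of_mem (hN0 z hz.1 hz.2)
      rcases i with _ | i
      · exact absurd hz.2 (G.loopless.irrefl _)
      · rw [Finset.mem_image]
        refine ⟨i, Finset.mem_filter.2 ⟨Finset.mem_range.2 (by omega), hi, hz.2⟩, ?_⟩
        simp [List.getD, hi]
    exact (Finset.card_le_card this).trans Finset.card_image_le
  have hB : dIn G S p[m-1] ≤ B.card := by
    have : S.filter (G.Adj p[m-1]) ⊆ B.image (fun i => p.getD i p[0]) := by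
      intro z hz
      rw [Finset.mem_filter] at hz
      obtain ⟨i, hi, rfl⟩ := List.getElem_of_mem (hN1 z hz.1 hz.2)
      by_cases him : i = m - 1
      · subst him
        exact absurd hz.2 (G.loopless.irrefl _)
      · rw [Finset.mem_image]
        refine ⟨i, Finset.mem_filter.2 ⟨Finset.mem_range.2 (by omega), hi, hz.2⟩, ?_⟩
        simp [List.getD, hi]
    exact (Finset.card_le_card this).trans Finset.card_image_le
  have hd0 := hdeg _ (hS _ (List.getElem_mem h0))
  have hd1 := hdeg _ (hS _ (List.getElem_mem hlast))
  have hU : (A ∪ B).card ≤ m - 1 := by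
    have : A ∪ B ⊆ Finset.range (m-1) :=
      Finset.union_subset (Finset.filter_subset _ _) (Finset.filter_subset _ _)
    simpa using Finset.card_le_card this
  have hI : 0 < (A ∩ B).card := by
    have := Finset.card_union_add_card_inter A B
    omega
  obtain ⟨i, hi⟩ := Finset.card_pos.1 hI
  rw [Finset.mem_inter, Finset.mem_filter, Finset.mem_filter] at hi
  obtain ⟨⟨_, hi1, ha⟩, ⟨_, hi2, hb⟩⟩ := hi
  have hperm : (p.take (i+1) ++ (p.drop (i+1)).reverse).Perm p := by
    conv_rhs => rw [← List.take_append_drop (i+1) p]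
    exact (List.reverse_perm _).append_left _
  have hch' := hch
  rw [← List.take_append_drop (i+1) p, List.isChain_append] at hch'
  refine ⟨p.take (i+1) ++ (p.drop (i+1)).reverse, by rw [hperm.length_eq, hl],
    hperm.nodup_iff.2 hnd, ?_, fun x hx => hS x (hperm.mem_iff.1 hx), ?_⟩
  · rw [List.isChain_append]
    refine ⟨hch'.1, ?_, ?_⟩
    · rw [List.isChain_reverse]
      exact hch'.2.1.imp (fun a b h => h.symm)
    · intro a ha' b hb'
      have e1 : a = p[i] := getLast?_take_aux p i hi2 a ha'
      have e2 : b = p[m-1] := by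
        rw [List.head?_reverse, List.getLast?_drop, if_neg (by omega),
          List.getLast?_eq_getElem?, hl, List.getElem?_eq_getElem hlast] at hb'
        exact (Option.some.inj hb').symm
      rw [e1, e2]; exact hb.symm
  · intro a ha' b hb'
    have e1 : a = p[i+1] := by
      rw [List.getLast?_append, List.getLast?_reverse, List.head?_drop,
        List.getElem?_eq_getElem hi1] at ha'
      simp at ha'
      exact ha'.symm
    have e2 : b = p[0] := by
      rw [List.head?_append, List.head?_take, if_neg (by omega), List.head?_eq_getElem?,
        List.getElem?_eq_getElem h0] at hb'
      exact (Option.some.inj hb').symm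
    rw [e1, e2]; exact ha.symm

theorem erdos_gallai {V : Type*} (G : SimpleGraph V) (k : ℕ) (hk : 1 ≤ k) :
    ∀ (n : ℕ) (S : Finset V), S.card = n → (k - 1) * S.card < ∑ x ∈ S, dIn G S x →
      PathIn G S (k + 1) := by
  classical
  intro n
  induction n using Nat.strong_induction_on with
  | _ n ih =>
  intro S hSn hS
  have mono : ∀ T ⊆ S, PathIn G T (k+1) → PathIn G S (k+1) := by
    rintro T hT ⟨l, h1, h2, h3, h4⟩
    exact ⟨l, h1, h2, h3, fun x hx => hT (h4 x hx)⟩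
  by_cases hlow : ∃ x ∈ S, 2 * dIn G S x ≤ k - 1
  · obtain ⟨x, hx, hd⟩ := hlow
    have hc := Finset.card_erase_add_one hx
    refine mono _ (Finset.erase_subset x S) (ih _ (by omega) (S.erase x) rfl ?_)
    have h1 : ∑ y ∈ S, dIn G S y = ∑ y ∈ S.erase x, dIn G S y + dIn G S x :=
      (Finset.sum_erase_add _ _ hx).symm
    have h2 : ∑ y ∈ S.erase x, dIn G S y ≤
        ∑ y ∈ S.erase x, (dIn G (S.erase x) y + if G.Adj x y then 1 else 0) := by
      apply Finset.sum_le_sum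
      intro y hy
      unfold dIn
      rw [Finset.filter_erase]
      have := Finset.pred_card_le_card_erase (s := S.filter (G.Adj y)) (a := x)
      split_ifs with h
      · omega
      · rw [Finset.erase_eq_of_notMem]
        · omega
        · simp [G.adj_comm, h]
    rw [Finset.sum_add_distrib] at h2
    have h3 : (∑ y ∈ S.erase x, if G.Adj x y then 1 else 0) ≤ dIn G S x := by
      rw [← Finset.card_filter]
      exact Finset.card_le_card (Finset.filter_subset_filter _ (Finset.erase_subset _ _))
    rw [← hc, mul_add] at hS
    omega
  · push Not at hlow
    by_contra hno
    have hSne : S.Nonempty := by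
      rw [Finset.nonempty_iff_ne_empty]; rintro rfl; simp at hS
    obtain ⟨s, hs⟩ := hSne
    have : ∃ m, 1 ≤ m ∧ m ≤ k ∧ PathIn G S m ∧ ¬ PathIn G S (m+1) := by
      by_contra hcon
      push Not at hcon
      have : ∀ j, j ≤ k → PathIn G S (j+1) := by
        intro j
        induction j with
        | zero => intro _; exact ⟨[s], by simp, by simp, by simp, by simpa using hs⟩
        | succ j ihj => intro hj; exact hcon (j+1) (by omega) hj (ihj (by omega))
      exact hno (this k le_rfl)
    obtain ⟨m, hm1, hmk, hp, hnp⟩ := this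
    obtain ⟨c, hcl, hcnd, hcch, hcS, hcc⟩ :=
      posa G S k m hmk hm1 (fun x hx => by have := hlow x hx; omega) hp hnp
    have hout : ∀ x ∈ c, ∀ z ∈ S, G.Adj x z → z ∈ c := by
      intro x hx z hz hxz
      by_contra hzc
      exact hnp (hcl ▸ rot_extend G S c hcnd hcch hcS hcc x z hx hzc hz hxz)
    have hCS : c.toFinset ⊆ S := fun x hx => hcS x (by simpa using hx)
    have hCc : c.toFinset.card = m := by rw [List.toFinset_card_of_nodup hcnd, hcl]
    have hcard : (S \ c.toFinset).card + m = S.card := by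
      rw [← hCc]; exact Finset.card_sdiff_add_card_eq_card hCS
    apply hno
    refine mono _ Finset.sdiff_subset (ih _ (by omega) (S \ c.toFinset) rfl ?_)
    have h1 : ∑ x ∈ S \ c.toFinset, dIn G S x + ∑ x ∈ c.toFinset, dIn G S x
        = ∑ x ∈ S, dIn G S x := Finset.sum_sdiff hCS
    have h2 : ∑ x ∈ c.toFinset, dIn G S x ≤ m * (k-1) := by
      rw [← hCc, ← smul_eq_mul]
      apply Finset.sum_le_card_nsmul
      intro x hx
      have : S.filter (G.Adj x) ⊆ c.toFinset.erase x := by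
        intro z hz
        rw [Finset.mem_filter] at hz
        rw [Finset.mem_erase, List.mem_toFinset]
        exact ⟨hz.2.ne', hout x (by simpa using hx) z hz.1 hz.2⟩
      have h := Finset.card_le_card this
      rw [Finset.card_erase_of_mem hx, hCc] at h
      unfold dIn
      omega
    have h3 : ∑ x ∈ S \ c.toFinset, dIn G S x = ∑ x ∈ S \ c.toFinset, dIn G (S \ c.toFinset) x := by
      apply Finset.sum_congr rfl
      intro x hx
      unfold dIn
      congr 1
      ext z
      simp only [Finset.mem_filter, Finset.mem_sdiff, List.mem_toFinset] at hx ⊢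
      refine ⟨fun h => ⟨⟨h.1, fun hzc => hx.2 (hout z hzc x hx.1 h.2.symm)⟩, h.2⟩,
        fun h => ⟨h.1.1, h.2⟩⟩
    rw [← hcard, mul_add, mul_comm (k-1) m] at hS
    omega

theorem cycle_of_path {V : Type*} (G : SimpleGraph V) (S : Finset V) (v : V)
    (hv : ∀ x ∈ S, G.Adj v x) (k : ℕ) (hk : 1 ≤ k) (hp : PathIn G S (k + 1)) :
    ∃ c : G.Walk v v, c.IsCycle ∧ c.length = k + 2 := by
  obtain ⟨l, hl, hnd, hch, hS⟩ := hp
  have hvl : v ∉ l := fun h => G.loopless.irrefl v (hv v (hS v h))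
  match l, hl with
  | [a], hl => simp at hl; omega
  | a :: b :: l, hl =>
    have key : ∀ (l : List V) (b : V), (b :: l).IsChain G.Adj → (∀ x ∈ b :: l, G.Adj v x) →
        ∃ w : G.Walk b v, w.support = b :: l ++ [v] := by
      intro l
      induction l with
      | nil => intro b _ h; exact ⟨.cons (h b (by simp)).symm .nil, by simp⟩
      | cons c l ih =>
        intro b h1 h2
        rw [List.isChain_cons_cons] at h1
        obtain ⟨w, hw⟩ := ih c h1.2 (fun x hx => h2 x (List.mem_cons_of_mem _ hx))
        exact ⟨.cons h1.1 w, by simp [hw]⟩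
    have hab := List.isChain_cons_cons.1 hch
    obtain ⟨w, hw⟩ := key l b hab.2 (fun x hx => hv x (hS x (List.mem_cons_of_mem _ hx)))
    have hva : G.Adj v a := hv a (hS a (by simp))
    refine ⟨.cons hva (.cons hab.1 w), ?_, ?_⟩
    · rw [SimpleGraph.Walk.cons_isCycle_iff]
      constructor
      · rw [SimpleGraph.Walk.isPath_def, SimpleGraph.Walk.support_cons, hw]
        have : (([v] ++ (a :: b :: l)) : List V).Nodup := List.nodup_cons.2 ⟨hvl, hnd⟩
        exact (List.perm_append_comm.nodup_iff).1 this
      · rw [SimpleGraph.Walk.edges_cons, List.mem_cons]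
        rintro (h | h)
        · rw [Sym2.eq_iff] at h
          simp at hvl
          rcases h with h | h <;> tauto
        · have := w.snd_mem_support_of_mem_edges h
          rw [hw] at this
          simp at hvl hnd this
          rcases this with h | h | h
          · exact hnd.1.1 h
          · exact hnd.1.2 h
          · exact hvl.1 h.symm
    · have := w.length_support
      rw [hw] at this
      simp at this hl ⊢
      omega

open Classical in
theorem sum_deg_le {V : Type*} [Fintype V] (G : SimpleGraph V) :
    ∑ v : V, (Finset.univ.filter (G.Adj v)).card ≤ 2 * cliqueCount G 2 := by
  have e : cliqueCount G 2 = (Finset.univ.filter (fun s : Finset V => G.IsNClique 2 s)).card := by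
    rw [cliqueCount, ← Set.ncard_coe_finset]; congr 1; ext; simp
  rw [← Finset.card_sigma, e]
  rw [mul_comm]
  have : ((Finset.univ.sigma fun v : V => Finset.univ.filter (G.Adj v))).card =
      ∑ s ∈ Finset.univ.filter (fun s : Finset V => G.IsNClique 2 s),
        ((Finset.univ.sigma fun v : V => Finset.univ.filter (G.Adj v)).filter
          (fun q => ({q.1, q.2} : Finset V) = s)).card := by
    apply Finset.card_eq_sum_card_fiberwise
    rintro ⟨a, b⟩ h
    simp at h ⊢
    rw [SimpleGraph.isNClique_iff]
    refine ⟨?_, Finset.card_pair h.ne⟩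
    simp [h]
  rw [this, ← smul_eq_mul]
  apply Finset.sum_le_card_nsmul
  intro s hs
  simp only [Finset.mem_filter, Finset.mem_univ, true_and, SimpleGraph.isNClique_iff] at hs
  obtain ⟨a, b, hab, rfl⟩ := Finset.card_eq_two.1 hs.2
  refine (Finset.card_le_card (t := {⟨a, b⟩, ⟨b, a⟩}) ?_).trans Finset.card_le_two
  rintro ⟨x, y⟩ h
  simp only [Finset.mem_filter, Finset.mem_sigma, Finset.mem_univ, true_and] at h
  obtain ⟨h1, h2⟩ := h
  have hne := h1.ne
  have hx : x ∈ ({a, b} : Finset V) := by rw [← h2]; simp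
  have hy : y ∈ ({a, b} : Finset V) := by rw [← h2]; simp
  simp at hx hy ⊢
  grind

open Classical in
theorem sum_tri_ge {V : Type*} [Fintype V] (G : SimpleGraph V) :
    6 * cliqueCount G 3 ≤ ∑ v : V, ∑ x ∈ Finset.univ.filter (G.Adj v),
      dIn G (Finset.univ.filter (G.Adj v)) x := by
  have e : cliqueCount G 3 = (Finset.univ.filter (fun s : Finset V => G.IsNClique 3 s)).card := by
    rw [cliqueCount, ← Set.ncard_coe_finset]; congr 1; ext; simp
  let T : Finset (V × V × V) := Finset.univ.filter
    (fun q => G.Adj q.1 q.2.1 ∧ G.Adj q.1 q.2.2 ∧ G.Adj q.2.1 q.2.2)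
  have hT : ∑ v : V, ∑ x ∈ Finset.univ.filter (G.Adj v),
      dIn G (Finset.univ.filter (G.Adj v)) x = T.card := by
    simp only [T, dIn, Finset.card_filter, Finset.sum_filter, Fintype.sum_prod_type]
    refine Finset.sum_congr rfl fun v _ => Finset.sum_congr rfl fun x _ => ?_
    by_cases h : G.Adj v x
    · simp only [h, if_true, true_and, ite_and]
    · simp [h]
  rw [hT, e, mul_comm]
  have : T.card = ∑ s ∈ Finset.univ.filter (fun s : Finset V => G.IsNClique 3 s),
        (T.filter (fun q => ({q.1, q.2.1, q.2.2} : Finset V) = s)).card := by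
    apply Finset.card_eq_sum_card_fiberwise
    rintro ⟨a, b, c⟩ h
    simp [T] at h ⊢
    rw [SimpleGraph.is3Clique_triple_iff]
    exact h
  rw [this, ← smul_eq_mul]
  apply Finset.card_nsmul_le_sum
  intro s hs
  simp only [Finset.mem_filter, Finset.mem_univ, true_and] at hs
  obtain ⟨a, b, c, hab, hac, hbc, rfl⟩ := SimpleGraph.is3Clique_iff.1 hs
  have h6 : ({(a,b,c),(a,c,b),(b,a,c),(b,c,a),(c,a,b),(c,b,a)} : Finset (V × V × V)).card = 6 := by
    have := hab.ne
    have := hac.ne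
    have := hbc.ne
    have := hab.ne'
    have := hac.ne'
    have := hbc.ne'
    repeat rw [Finset.card_insert_of_notMem (by simp [*])]
    simp
  rw [← h6]
  apply Finset.card_le_card
  intro q hq
  have := hab.symm
  have := hac.symm
  have := hbc.symm
  simp only [Finset.mem_insert, Finset.mem_singleton] at hq
  simp only [T, Finset.mem_filter, Finset.mem_univ, true_and]
  rcases hq with rfl | rfl | rfl | rfl | rfl | rfl <;> refine ⟨by simp [*], ?_⟩ <;>
    · ext z; simp; try tauto

/-- A graph with at least one edge contains a cycle of length `t` for every
`t` with `3 ≤ t ≤ 3·N_3(G)/N_2(G) + 2`. -/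
theorem cycles_up_to_triangle_edge_ratio {V : Type*} [Fintype V] (G : SimpleGraph V)
    (hE : 0 < cliqueCount G 2) (t : ℕ) (ht3 : 3 ≤ t)
    (ht : (t : ℚ) ≤ 3 * (cliqueCount G 3 : ℚ) / (cliqueCount G 2 : ℚ) + 2) :
    ∃ (v : V) (c : G.Walk v v), c.IsCycle ∧ c.length = t := by
  classical
  obtain ⟨k, rfl⟩ : ∃ k, t = k + 1 + 2 := ⟨t - 3, by omega⟩
  have hE' : (0 : ℚ) < cliqueCount G 2 := by exact_mod_cast hE
  have h1 : (k + 1) * cliqueCount G 2 ≤ 3 * cliqueCount G 3 := by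
    have : ((k : ℚ) + 1) ≤ 3 * (cliqueCount G 3 : ℚ) / (cliqueCount G 2 : ℚ) := by
      push_cast at ht; linarith
    rw [le_div_iff₀ hE'] at this
    exact_mod_cast this
  have h2 := sum_deg_le G
  have h3 := sum_tri_ge G
  have h4 : ∑ v : V, k * (Finset.univ.filter (G.Adj v)).card <
      ∑ v : V, ∑ x ∈ Finset.univ.filter (G.Adj v),
        dIn G (Finset.univ.filter (G.Adj v)) x := by
    rw [← Finset.mul_sum]
    nlinarith
  obtain ⟨v, _, hv⟩ := Finset.exists_lt_of_sum_lt h4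
  have hp := erdos_gallai G (k+1) (by omega) _ (Finset.univ.filter (G.Adj v)) rfl (by simpa using hv)
  obtain ⟨c, hc⟩ := cycle_of_path G _ v (by simp) (k+1) (by omega) hp
  exact ⟨v, c, hc⟩
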